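/- (Theorem 3, exponential boundedness of the closed-loop state trajectory) Suppose Q_1(t) + Σ_{i=2}^M Q_i(t) is positive definite for every t ∈ [t_0, t_f] and S_{1f} + Σ_{i=2}^M S_{if} is positive definite, and let {S_1, …, S_M} be a solution set of the AAO coupled Riccati equations on [t_0, t_f]. Define P(t) = Σ_{i=1}^M S_i(t), Ā(t) = A(t) − Σ_{j=1}^M H_j(t) S_j(t), Q̂(t) = Σ_{i=1}^M Q_i(t), λ̲_{Q̂} = min_{t ∈ [t_0,t_f]} λ_min(Q̂(t)) > 0, λ̄_P = max_{t ∈ [t_0,t_f]} λ_max(P(t)), and λ̲_P = min_{t ∈ [t_0,t_f]} λ_min(P(t)) > 0. Let x : [t_0, t_f] → ℝⁿ solve ẋ(t) = Ā(t) x(t) with x(t_0) = x_0 ≠ 0. Then for every r > 0, if t_f − t_0 ≥ (λ̄_P/λ̲_{Q̂}) · ( 2 ln(‖x_0‖/r) + ln(λ̄_P/λ̲_P) ), then ‖x(t_f)‖ ≤ r. -/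

import Mathlib

open Matrix Set

/-- The largest eigenvalue of a symmetric real matrix, as the supremum of the
Rayleigh quotient over the unit sphere. -/
noncomputable def lamMax {n : ℕ} (X : Matrix (Fin n) (Fin n) ℝ) : ℝ :=
  sSup {r : ℝ | ∃ v : Fin n → ℝ, v ⬝ᵥ v = 1 ∧ r = v ⬝ᵥ X.mulVec v}

/-- The smallest eigenvalue of a symmetric real matrix, as the infimum of the
Rayleigh quotient over the unit sphere. -/
noncomputable def lamMin {n : ℕ} (X : Matrix (Fin n) (Fin n) ℝ) : ℝ :=
  sInf {r : ℝ | ∃ v : Fin n → ℝ, v ⬝ᵥ v = 1 ∧ r = v ⬝ᵥ X.mulVec v}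

/-- The quadratic form of a continuous matrix function depends continuously
on time and vector jointly. -/
theorem continuousOn_quadForm {n : ℕ} {s : Set ℝ} {F : ℝ → Matrix (Fin n) (Fin n) ℝ}
    (hF : ∀ k l, ContinuousOn (fun t => F t k l) s) (T : Set (Fin n → ℝ)) :
    ContinuousOn (fun p : ℝ × (Fin n → ℝ) => p.2 ⬝ᵥ F p.1 *ᵥ p.2) (s ×ˢ T) := by
  simp only [dotProduct, mulVec]
  refine continuousOn_finsetSum _ fun k _ => ContinuousOn.mul (by fun_prop) ?_
  refine continuousOn_finsetSum _ fun l _ => ContinuousOn.mul ?_ (by fun_prop)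
  exact (hF k l).comp continuousOn_fst fun p hp => hp.1

theorem isCompact_dotProduct_sphere (n : ℕ) : IsCompact {v : Fin n → ℝ | v ⬝ᵥ v = 1} := by
  refine Metric.isCompact_of_isClosed_isBounded ?_ ?_
  · refine isClosed_eq ?_ continuous_const
    simp only [dotProduct]
    fun_prop
  · refine (Metric.isBounded_closedBall (x := (0 : Fin n → ℝ)) (r := 1)).subset fun v hv => ?_
    rw [mem_closedBall_zero_iff, pi_norm_le_iff_of_nonneg zero_le_one]
    intro i
    have h : v i * v i ≤ v ⬝ᵥ v :=
      Finset.single_le_sum (f := fun i => v i * v i) (fun j _ => mul_self_nonneg (v j))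
        (Finset.mem_univ i)
    rw [mem_ofPred_eq] at hv
    rw [Real.norm_eq_abs]
    exact abs_le_one_iff_mul_self_le_one.2 (by linarith)

theorem dotProduct_sphere_nonempty {n : ℕ} (hn : 1 ≤ n) :
    {v : Fin n → ℝ | v ⬝ᵥ v = 1}.Nonempty :=
  ⟨Pi.single ⟨0, hn⟩ 1, by simp⟩

/-- A bound for the quadratic form on the unit sphere scales to all vectors. -/
theorem mul_dotProduct_le_quadForm {n : ℕ} {X : Matrix (Fin n) (Fin n) ℝ} {c : ℝ}
    (h : ∀ v : Fin n → ℝ, v ⬝ᵥ v = 1 → c ≤ v ⬝ᵥ X *ᵥ v) (v : Fin n → ℝ) :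
    c * (v ⬝ᵥ v) ≤ v ⬝ᵥ X *ᵥ v := by
  rcases eq_or_ne v 0 with rfl | hv
  · simp
  have hpos : 0 < v ⬝ᵥ v := by simpa using dotProduct_star_self_pos_iff.2 hv
  have hs : Real.sqrt (v ⬝ᵥ v) ≠ 0 := (Real.sqrt_pos.2 hpos).ne'
  have hsq : Real.sqrt (v ⬝ᵥ v) * Real.sqrt (v ⬝ᵥ v) = v ⬝ᵥ v := Real.mul_self_sqrt hpos.le
  have key := h ((Real.sqrt (v ⬝ᵥ v))⁻¹ • v) (by
    rw [smul_dotProduct, dotProduct_smul, smul_eq_mul, smul_eq_mul, ← mul_assoc, ← mul_inv, hsq,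
      inv_mul_cancel₀ hpos.ne'])
  rw [mulVec_smul, smul_dotProduct, dotProduct_smul, smul_eq_mul, smul_eq_mul, ← mul_assoc,
    ← mul_inv, hsq, inv_mul_eq_div, le_div_iff₀ hpos] at key
  exact key

theorem mul_lamMin_le_quadForm {n : ℕ} (hn : 1 ≤ n) {a b : ℝ}
    {F : ℝ → Matrix (Fin n) (Fin n) ℝ}
    (hF : ∀ k l, ContinuousOn (fun t => F t k l) (Icc a b)) {t : ℝ} (ht : t ∈ Icc a b)
    (v : Fin n → ℝ) :
    sInf ((fun t => lamMin (F t)) '' Icc a b) * (v ⬝ᵥ v) ≤ v ⬝ᵥ F t *ᵥ v := by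
  refine mul_dotProduct_le_quadForm (fun w hw => ?_) v
  obtain ⟨c, hc⟩ := (isCompact_Icc.prod (isCompact_dotProduct_sphere n)).bddBelow_image
    (continuousOn_quadForm hF _)
  have hc' : ∀ s ∈ Icc a b, ∀ u : Fin n → ℝ, u ⬝ᵥ u = 1 → c ≤ u ⬝ᵥ F s *ᵥ u :=
    fun s hs u hu => hc ⟨(s, u), ⟨hs, hu⟩, rfl⟩
  trans lamMin (F t)
  · refine csInf_le ⟨c, ?_⟩ (mem_image_of_mem _ ht)
    rintro _ ⟨s, hs, rfl⟩
    obtain ⟨u, hu⟩ := dotProduct_sphere_nonempty hn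
    refine le_csInf ⟨_, u, hu, rfl⟩ ?_
    rintro _ ⟨u, hu, rfl⟩
    exact hc' s hs u hu
  · refine csInf_le ⟨c, ?_⟩ ⟨w, hw, rfl⟩
    rintro _ ⟨u, hu, rfl⟩
    exact hc' t ht u hu

theorem lamMax_eq_neg_lamMin_neg {n : ℕ} (X : Matrix (Fin n) (Fin n) ℝ) :
    lamMax X = -lamMin (-X) := by
  rw [lamMin, Real.sInf_def, neg_neg, lamMax]
  congr 1
  ext r
  simp [neg_mulVec, neg_eq_iff_eq_neg]

theorem quadForm_le_mul_lamMax {n : ℕ} (hn : 1 ≤ n) {a b : ℝ}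
    {F : ℝ → Matrix (Fin n) (Fin n) ℝ}
    (hF : ∀ k l, ContinuousOn (fun t => F t k l) (Icc a b)) {t : ℝ} (ht : t ∈ Icc a b)
    (v : Fin n → ℝ) :
    v ⬝ᵥ F t *ᵥ v ≤ sSup ((fun t => lamMax (F t)) '' Icc a b) * (v ⬝ᵥ v) := by
  have h := mul_lamMin_le_quadForm hn (F := fun t => -F t) (fun k l => (hF k l).neg) ht v
  have e : sSup ((fun t => lamMax (F t)) '' Icc a b)
      = -sInf ((fun t => lamMin (-F t)) '' Icc a b) := by
    rw [Real.sInf_def, neg_neg]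
    congr 1
    ext r
    simp [lamMax_eq_neg_lamMin_neg, neg_eq_iff_eq_neg]
  rw [neg_mulVec, dotProduct_neg] at h
  rw [e]
  linarith

theorem sInf_lamMin_pos {n : ℕ} (hn : 1 ≤ n) {a b : ℝ} (hab : a ≤ b)
    {F : ℝ → Matrix (Fin n) (Fin n) ℝ}
    (hF : ∀ k l, ContinuousOn (fun t => F t k l) (Icc a b))
    (hpos : ∀ t ∈ Icc a b, ∀ v : Fin n → ℝ, v ⬝ᵥ v = 1 → 0 < v ⬝ᵥ F t *ᵥ v) :
    0 < sInf ((fun t => lamMin (F t)) '' Icc a b) := by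
  have hne := dotProduct_sphere_nonempty hn
  obtain ⟨⟨s, u⟩, ⟨hs, hu⟩, hmin⟩ :=
    (isCompact_Icc.prod (isCompact_dotProduct_sphere n)).exists_isMinOn
      ((nonempty_Icc.2 hab).prod hne) (continuousOn_quadForm hF _)
  refine (hpos s hs u hu).trans_le (le_csInf ((nonempty_Icc.2 hab).image _) ?_)
  rintro _ ⟨t, ht, rfl⟩
  refine le_csInf ⟨_, u, hu, rfl⟩ ?_
  rintro _ ⟨v, hv, rfl⟩
  exact hmin (mk_mem_prod ht hv : ((t, v) : ℝ × (Fin n → ℝ)) ∈ _)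

theorem HasDerivWithinAt.quadForm {n : ℕ} {s : Set ℝ} {t : ℝ}
    {P : ℝ → Matrix (Fin n) (Fin n) ℝ} {P' : Matrix (Fin n) (Fin n) ℝ}
    {x : ℝ → Fin n → ℝ} {x' : Fin n → ℝ}
    (hP : ∀ k l, HasDerivWithinAt (fun s => P s k l) (P' k l) s t)
    (hx : ∀ k, HasDerivWithinAt (fun s => x s k) (x' k) s t) :
    HasDerivWithinAt (fun s => x s ⬝ᵥ P s *ᵥ x s)
      (x' ⬝ᵥ P t *ᵥ x t + x t ⬝ᵥ (P' *ᵥ x t + P t *ᵥ x')) s t := by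
  have h := HasDerivWithinAt.fun_sum (u := Finset.univ) fun k _ =>
    (hx k).fun_mul (HasDerivWithinAt.fun_sum (u := Finset.univ) fun l _ =>
      (hP k l).fun_mul (hx l))
  refine h.congr_deriv ?_
  simp only [dotProduct, mulVec, Pi.add_apply, Finset.sum_add_distrib]

/-- A symmetric solution of a Lyapunov equation `P' + P B + Bᵀ P + R = 0` with `R` positive
definite is positive definite on the whole interval if it is so at the right end point. -/
theorem lyapunov_quadForm_pos {n : ℕ} {a b : ℝ}
    {P P' B R : ℝ → Matrix (Fin n) (Fin n) ℝ}
    (hsymm : ∀ t ∈ Icc a b, (P t).IsSymm)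
    (hP : ∀ t ∈ Icc a b, ∀ k l,
      HasDerivWithinAt (fun s => P s k l) (P' t k l) (Icc a b) t)
    (heq : ∀ t ∈ Icc a b, P' t + P t * B t + (B t)ᵀ * P t + R t = 0)
    (hR : ∀ t ∈ Icc a b, ∀ v : Fin n → ℝ, v ⬝ᵥ v = 1 → 0 < v ⬝ᵥ R t *ᵥ v)
    (hb : ∀ v : Fin n → ℝ, v ⬝ᵥ v = 1 → 0 < v ⬝ᵥ P b *ᵥ v) :
    ∀ t ∈ Icc a b, ∀ v : Fin n → ℝ, v ⬝ᵥ v = 1 → 0 < v ⬝ᵥ P t *ᵥ v := by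
  by_contra! hcon
  obtain ⟨t₁, ht₁, v₁, hv₁, hneg⟩ := hcon
  have hPc : ∀ k l, ContinuousOn (fun t => P t k l) (Icc a b) :=
    fun k l t ht => (hP t ht k l).continuousWithinAt
  have hcomp := isCompact_Icc.prod (isCompact_dotProduct_sphere n) (s := Icc a b)
  have hK := hcomp.of_isClosed_subset
    ((continuousOn_quadForm hPc _).preimage_isClosed_of_isClosed hcomp.isClosed
      (isClosed_Iic (a := (0 : ℝ)))) inter_subset_left
  obtain ⟨⟨t, v⟩, ⟨⟨ht, hv⟩, hle⟩, hmax⟩ :=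
    hK.exists_isMaxOn ⟨(t₁, v₁), ⟨ht₁, hv₁⟩, hneg⟩ continuousOn_fst
  simp only [mem_preimage, mem_Iic, mem_ofPred_eq] at ht hv hle
  have hlt : t < b := lt_of_le_of_ne ht.2 fun h => (hb v hv).not_ge (h ▸ hle)
  have hafter : ∀ s ∈ Ioc t b, ∀ w : Fin n → ℝ, w ⬝ᵥ w = 1 → 0 < w ⬝ᵥ P s *ᵥ w := by
    intro s hs w hw
    by_contra! h
    have : s ≤ t := hmax (a := (s, w)) ⟨⟨⟨ht.1.trans hs.1.le, hs.2⟩, hw⟩, h⟩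
    exact this.not_gt hs.1
  have hsub : Ioc t b ⊆ Icc a b := fun s hs => ⟨ht.1.trans hs.1.le, hs.2⟩
  have hbot : (nhdsWithin t (Ioc t b)).NeBot := by
    rw [nhdsWithin_Ioc_eq_nhdsGT hlt]
    infer_instance
  have hnonneg : ∀ w : Fin n → ℝ, w ⬝ᵥ w = 1 → 0 ≤ w ⬝ᵥ P t *ᵥ w := by
    intro w hw
    have hd := HasDerivWithinAt.quadForm (hP t ht)
      (x := fun _ => w) (fun k => hasDerivWithinAt_const t (Icc a b) (w k)) (x' := 0)
    exact ge_of_tendsto (hd.continuousWithinAt.mono hsub)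
      (eventually_nhdsWithin_of_forall fun s hs => (hafter s hs w hw).le)
  have hpsd : (P t).PosSemidef := by
    refine PosSemidef.of_dotProduct_mulVec_nonneg (by simpa using hsymm t ht) fun w => ?_
    have := mul_dotProduct_le_quadForm (c := 0) hnonneg w
    simpa using this
  have hzero : v ⬝ᵥ P t *ᵥ v = 0 := le_antisymm hle (hnonneg v hv)
  have hPv : P t *ᵥ v = 0 := (hpsd.dotProduct_mulVec_zero_iff v).1 (by simpa using hzero)
  have hvP : v ᵥ* P t = 0 := by
    rw [← hPv, ← vecMul_transpose, (hsymm t ht).eq]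
  have hd := HasDerivWithinAt.quadForm (hP t ht)
    (x := fun _ => v) (fun k => hasDerivWithinAt_const t (Icc a b) (v k)) (x' := 0)
  have hval : v ⬝ᵥ P' t *ᵥ v = -(v ⬝ᵥ R t *ᵥ v) := by
    have h := congrArg (fun X => v ⬝ᵥ X *ᵥ v) (heq t ht)
    simp only [add_mulVec, dotProduct_add, zero_mulVec, dotProduct_zero, ← mulVec_mulVec, hPv,
      mulVec_zero, dotProduct_mulVec v (P t), hvP, zero_dotProduct] at h
    linarith
  have hslope : 0 ≤ v ⬝ᵥ P' t *ᵥ v := by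
    have h := hasDerivWithinAt_iff_tendsto_slope' (fun h => lt_irrefl t h.1) |>.1 (hd.mono hsub)
    simp only [zero_dotProduct, mulVec_zero, add_zero, zero_add] at h
    refine ge_of_tendsto h (eventually_nhdsWithin_of_forall fun s hs => ?_)
    rw [slope_def_field, hzero, sub_zero]
    exact div_nonneg (hafter s hs v hv).le (sub_nonneg.2 hs.1.le)
  linarith [hR t ht v hv]

/-- Along solutions of `x' = B x`, the Lyapunov function `x ⬝ᵥ P x` decays exponentially. -/
theorem lyapunov_quadForm_decay {n : ℕ} {a b c : ℝ} (hab : a ≤ b)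
    {P P' B R : ℝ → Matrix (Fin n) (Fin n) ℝ} {x : ℝ → Fin n → ℝ}
    (hP : ∀ t ∈ Icc a b, ∀ k l,
      HasDerivWithinAt (fun s => P s k l) (P' t k l) (Icc a b) t)
    (heq : ∀ t ∈ Icc a b, P' t + P t * B t + (B t)ᵀ * P t + R t = 0)
    (hR : ∀ t ∈ Icc a b, c * (x t ⬝ᵥ P t *ᵥ x t) ≤ x t ⬝ᵥ R t *ᵥ x t)
    (hx : ∀ t ∈ Icc a b, ∀ k,
      HasDerivWithinAt (fun s => x s k) ((B t *ᵥ x t) k) (Icc a b) t) :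
    (x b ⬝ᵥ P b *ᵥ x b) * Real.exp (c * (b - a)) ≤ x a ⬝ᵥ P a *ᵥ x a := by
  have hd : ∀ t ∈ Icc a b, HasDerivWithinAt
      (fun s => (x s ⬝ᵥ P s *ᵥ x s) * Real.exp (c * (s - a)))
      ((-(x t ⬝ᵥ R t *ᵥ x t)) * Real.exp (c * (t - a))
        + (x t ⬝ᵥ P t *ᵥ x t) * (Real.exp (c * (t - a)) * (c * 1))) (Icc a b) t := by
    intro t ht
    refine ((HasDerivWithinAt.quadForm (hP t ht) (hx t ht)).congr_deriv ?_).fun_mul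
      ((((hasDerivAt_id t).sub_const a).const_mul c).exp.hasDerivWithinAt)
    have h := congrArg (fun X => x t ⬝ᵥ X *ᵥ x t) (heq t ht)
    simp only [add_mulVec, dotProduct_add, zero_mulVec, dotProduct_zero, ← mulVec_mulVec] at h ⊢
    rw [dotProduct_mulVec (x t) (B t)ᵀ, vecMul_transpose] at h
    linarith
  have hanti : AntitoneOn (fun s => (x s ⬝ᵥ P s *ᵥ x s) * Real.exp (c * (s - a))) (Icc a b) := by
    refine antitoneOn_of_hasDerivWithinAt_nonpos (convex_Icc a b)
      (fun t ht => (hd t ht).continuousWithinAt)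
      (fun t ht => (hd t (interior_subset ht)).mono interior_subset) fun t ht => ?_
    nlinarith [hR t (interior_subset ht), Real.exp_pos (c * (t - a))]
  simpa using hanti (left_mem_Icc.2 hab) (right_mem_Icc.2 hab) hab

/-- Summing the coupled Riccati equations gives a Lyapunov equation for the sum. -/
theorem sum_riccati {n M : ℕ} {A : Matrix (Fin n) (Fin n) ℝ}
    {H Q S S' : Fin M → Matrix (Fin n) (Fin n) ℝ}
    (hH : ∀ i, (H i).IsSymm) (hS : ∀ i, (S i).IsSymm)
    (hRic : ∀ i, S' i + S i * A + Aᵀ * S i + Q i + S i * H i * S i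
        - ∑ j, (S i * H j * S j + S j * H j * S i) = 0) :
    (∑ i, S' i) + (∑ i, S i) * (A - ∑ j, H j * S j) + (A - ∑ j, H j * S j)ᵀ * (∑ i, S i)
      + ((∑ i, Q i) + ∑ i, S i * H i * S i) = 0 := by
  have h := Finset.sum_eq_zero fun i (_ : i ∈ Finset.univ) => hRic i
  simp only [Finset.sum_sub_distrib, Finset.sum_add_distrib] at h
  have h1 : ∑ i, ∑ j, S i * H j * S j = (∑ i, S i) * ∑ j, H j * S j := by
    rw [Finset.sum_mul_sum]
    simp only [Matrix.mul_assoc]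
  have h2 : ∑ i, ∑ j, S j * H j * S i = (∑ j, H j * S j)ᵀ * ∑ i, S i := by
    rw [transpose_sum, Finset.sum_mul_sum, Finset.sum_comm]
    simp only [transpose_mul, (hH _).eq, (hS _).eq]
  rw [h1, h2, ← Finset.sum_mul, ← Finset.mul_sum] at h
  rw [← h, transpose_sub, Matrix.mul_sub, Matrix.sub_mul]
  abel

/-- **Theorem 3 (exponential boundedness of the closed-loop state trajectory).**
Under the positivity hypotheses of Lemma 3, for every `r > 0`, if
`t_f − t_0 ≥ (λ̄_P/λ̲_{Q̂}) (2 ln(‖x_0‖/r) + ln(λ̄_P/λ̲_P))` then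
`‖x(t_f)‖ ≤ r`. -/
theorem aao_capture {n M : ℕ} [NeZero M] (hn : 1 ≤ n) (hM : 2 ≤ M)
    {t0 tf : ℝ} (ht : t0 < tf)
    (A : ℝ → Matrix (Fin n) (Fin n) ℝ)
    (H Q : Fin M → ℝ → Matrix (Fin n) (Fin n) ℝ)
    (Sf : Fin M → Matrix (Fin n) (Fin n) ℝ)
    (hAcont : ∀ k l, ContinuousOn (fun t => A t k l) (Icc t0 tf))
    (hHcont : ∀ i k l, ContinuousOn (fun t => H i t k l) (Icc t0 tf))
    (hQcont : ∀ i k l, ContinuousOn (fun t => Q i t k l) (Icc t0 tf))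
    (hHpsd : ∀ i, ∀ t ∈ Icc t0 tf, (H i t).PosSemidef)
    (hQ1 : ∀ t ∈ Icc t0 tf, (-(Q 0 t)).PosDef)
    (hQi : ∀ i : Fin M, i ≠ 0 → ∀ t ∈ Icc t0 tf, (Q i t).PosSemidef)
    (hSf1 : (-(Sf 0)).PosDef)
    (hSfi : ∀ i : Fin M, i ≠ 0 → (Sf i).PosSemidef)
    (S S' : Fin M → ℝ → Matrix (Fin n) (Fin n) ℝ)
    (hSsym : ∀ i, ∀ t ∈ Icc t0 tf, (S i t).IsSymm)
    (hSderiv : ∀ i, ∀ t ∈ Icc t0 tf, ∀ k l,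
      HasDerivWithinAt (fun s => S i s k l) (S' i t k l) (Icc t0 tf) t)
    (hS'cont : ∀ i k l, ContinuousOn (fun t => S' i t k l) (Icc t0 tf))
    (hRic : ∀ i, ∀ t ∈ Icc t0 tf,
      S' i t + S i t * A t + (A t)ᵀ * S i t + Q i t + S i t * H i t * S i t
        - ∑ j, (S i t * H j t * S j t + S j t * H j t * S i t) = 0)
    (hterm : ∀ i, S i tf = Sf i)
    (hQsum : ∀ t ∈ Icc t0 tf,
      (Q 0 t + ∑ i ∈ Finset.univ.erase 0, Q i t).PosDef)
    (hSfsum : (Sf 0 + ∑ i ∈ Finset.univ.erase 0, Sf i).PosDef)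
    (lamQhat lamPmax lamPmin : ℝ)
    (hlamQhat : lamQhat = sInf ((fun t => lamMin (∑ i, Q i t)) '' Icc t0 tf))
    (hlamPmax : lamPmax = sSup ((fun t => lamMax (∑ i, S i t)) '' Icc t0 tf))
    (hlamPmin : lamPmin = sInf ((fun t => lamMin (∑ i, S i t)) '' Icc t0 tf))
    (x0 : Fin n → ℝ) (x : ℝ → Fin n → ℝ)
    (hx : ∀ t ∈ Icc t0 tf, ∀ k,
      HasDerivWithinAt (fun s => x s k)
        (((A t - ∑ j, H j t * S j t).mulVec (x t)) k) (Icc t0 tf) t)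
    (hx0 : x t0 = x0)
    (hx0ne : x0 ≠ 0) :
    ∀ r : ℝ, 0 < r →
      (lamPmax / lamQhat)
          * (2 * Real.log (Real.sqrt (x0 ⬝ᵥ x0) / r)
              + Real.log (lamPmax / lamPmin)) ≤ tf - t0 →
      Real.sqrt (x tf ⬝ᵥ x tf) ≤ r := by
  intro r hr hT
  have hHsymm : ∀ t ∈ Icc t0 tf, ∀ i, (H i t).IsSymm := fun t ht i => by
    simpa using (hHpsd i t ht).isHermitian
  have hsplit : ∀ f : Fin M → Matrix (Fin n) (Fin n) ℝ,
      f 0 + ∑ i ∈ Finset.univ.erase 0, f i = ∑ i, f i :=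
    fun f => Finset.add_sum_erase _ f (Finset.mem_univ 0)
  have hunit : ∀ v : Fin n → ℝ, v ⬝ᵥ v = 1 → v ≠ 0 := by
    rintro v hv rfl
    simp at hv
  have hQc : ∀ k l, ContinuousOn (fun t => (∑ i, Q i t) k l) (Icc t0 tf) := fun k l => by
    simp only [Matrix.sum_apply]
    exact continuousOn_finsetSum _ fun i _ => hQcont i k l
  have hPd : ∀ t ∈ Icc t0 tf, ∀ k l, HasDerivWithinAt (fun s => (∑ i, S i s) k l)
      ((∑ i, S' i t) k l) (Icc t0 tf) t := fun t ht k l => by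
    simp only [Matrix.sum_apply]
    exact HasDerivWithinAt.fun_sum fun i _ => hSderiv i t ht k l
  have hPc : ∀ k l, ContinuousOn (fun t => (∑ i, S i t) k l) (Icc t0 tf) :=
    fun k l t ht => (hPd t ht k l).continuousWithinAt
  have hPsymm : ∀ t ∈ Icc t0 tf, (∑ i, S i t).IsSymm := fun t ht => by
    rw [Matrix.IsSymm, transpose_sum]
    exact Finset.sum_congr rfl fun i _ => hSsym i t ht
  have hlyap := fun t ht =>
    sum_riccati (hHsymm t ht) (fun i => hSsym i t ht) (fun i => hRic i t ht)
  have hQpos : ∀ t ∈ Icc t0 tf, ∀ v : Fin n → ℝ, v ⬝ᵥ v = 1 →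
      0 < v ⬝ᵥ (∑ i, Q i t) *ᵥ v := fun t ht v hv => by
    have h := (hQsum t ht).dotProduct_mulVec_pos (hunit v hv)
    rw [hsplit fun i => Q i t] at h
    simpa using h
  have hQle : ∀ t ∈ Icc t0 tf, ∀ v : Fin n → ℝ,
      v ⬝ᵥ (∑ i, Q i t) *ᵥ v
        ≤ v ⬝ᵥ ((∑ i, Q i t) + ∑ i, S i t * H i t * S i t) *ᵥ v := fun t ht v => by
    rw [add_mulVec, dotProduct_add, le_add_iff_nonneg_right, sum_mulVec, dotProduct_sum]
    refine Finset.sum_nonneg fun i _ => ?_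
    have h := (hHpsd i t ht).dotProduct_mulVec_nonneg (S i t *ᵥ v)
    rw [← mulVec_mulVec, ← mulVec_mulVec, dotProduct_mulVec, ← mulVec_transpose,
      (hSsym i t ht).eq]
    simpa using h
  have hPpos : ∀ t ∈ Icc t0 tf, ∀ v : Fin n → ℝ, v ⬝ᵥ v = 1 →
      0 < v ⬝ᵥ (∑ i, S i t) *ᵥ v := by
    refine lyapunov_quadForm_pos hPsymm hPd hlyap
      (fun t ht v hv => (hQpos t ht v hv).trans_le (hQle t ht v)) fun v hv => ?_
    have h := hSfsum.dotProduct_mulVec_pos (hunit v hv)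
    rw [hsplit Sf] at h
    simpa [hterm] using h
  have hmQ : 0 < lamQhat := hlamQhat ▸ sInf_lamMin_pos hn ht.le hQc hQpos
  have hmP : 0 < lamPmin := hlamPmin ▸ sInf_lamMin_pos hn ht.le hPc hPpos
  have hQlow : ∀ t ∈ Icc t0 tf, ∀ v : Fin n → ℝ,
      lamQhat * (v ⬝ᵥ v) ≤ v ⬝ᵥ (∑ i, Q i t) *ᵥ v :=
    fun t ht v => hlamQhat ▸ mul_lamMin_le_quadForm hn hQc ht v
  have hPlow : ∀ t ∈ Icc t0 tf, ∀ v : Fin n → ℝ,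
      lamPmin * (v ⬝ᵥ v) ≤ v ⬝ᵥ (∑ i, S i t) *ᵥ v :=
    fun t ht v => hlamPmin ▸ mul_lamMin_le_quadForm hn hPc ht v
  have hPup : ∀ t ∈ Icc t0 tf, ∀ v : Fin n → ℝ,
      v ⬝ᵥ (∑ i, S i t) *ᵥ v ≤ lamPmax * (v ⬝ᵥ v) :=
    fun t ht v => hlamPmax ▸ quadForm_le_mul_lamMax hn hPc ht v
  have ht0 : t0 ∈ Icc t0 tf := left_mem_Icc.2 ht.le
  have htf : tf ∈ Icc t0 tf := right_mem_Icc.2 ht.le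
  have ha : 0 < x0 ⬝ᵥ x0 := by simpa using dotProduct_star_self_pos_iff.2 hx0ne
  have hMP : 0 < lamPmax :=
    pos_of_mul_pos_left ((mul_pos hmP ha).trans_le ((hPlow t0 ht0 x0).trans (hPup t0 ht0 x0)))
      ha.le
  have hdecay := lyapunov_quadForm_decay (c := lamQhat / lamPmax) ht.le hPd hlyap
    (fun t ht => by
      refine le_trans ?_ ((hQlow t ht (x t)).trans (hQle t ht (x t)))
      rw [div_mul_eq_mul_div, div_le_iff₀ hMP, mul_assoc, mul_comm (x t ⬝ᵥ x t)]
      exact mul_le_mul_of_nonneg_left (hPup t ht (x t)) hmQ.le) hx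
  rw [hx0] at hdecay
  have hsq : 0 < Real.sqrt (x0 ⬝ᵥ x0) := Real.sqrt_pos.2 ha
  have hexp : (Real.sqrt (x0 ⬝ᵥ x0) / r) ^ 2 * (lamPmax / lamPmin)
      ≤ Real.exp (lamQhat / lamPmax * (tf - t0)) := by
    rw [← Real.log_le_iff_le_exp (by positivity), Real.log_mul (by positivity) (by positivity),
      Real.log_pow]
    rw [← inv_div lamPmax lamQhat, inv_mul_eq_div, le_div_iff₀ (by positivity), mul_comm]
    exact_mod_cast hT
  rw [div_pow, Real.sq_sqrt ha.le] at hexp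
  have hbnn : 0 ≤ x tf ⬝ᵥ x tf := by simpa using dotProduct_star_self_nonneg (x tf)
  have hfinal : lamPmin * (x tf ⬝ᵥ x tf) * ((x0 ⬝ᵥ x0) / r ^ 2 * (lamPmax / lamPmin))
      ≤ lamPmax * (x0 ⬝ᵥ x0) := by
    calc _ ≤ lamPmin * (x tf ⬝ᵥ x tf) * Real.exp (lamQhat / lamPmax * (tf - t0)) := by gcongr
      _ ≤ (x tf ⬝ᵥ (∑ i, S i tf) *ᵥ x tf) * Real.exp (lamQhat / lamPmax * (tf - t0)) := by
        gcongr
        exact hPlow tf htf (x tf)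
      _ ≤ x0 ⬝ᵥ (∑ i, S i t0) *ᵥ x0 := hdecay
      _ ≤ _ := hPup t0 ht0 x0
  refine Real.sqrt_le_iff.2 ⟨hr.le, ?_⟩
  have e : lamPmin * (x tf ⬝ᵥ x tf) * ((x0 ⬝ᵥ x0) / r ^ 2 * (lamPmax / lamPmin))
      = lamPmax * (x0 ⬝ᵥ x0) * ((x tf ⬝ᵥ x tf) / r ^ 2) := by
    field_simp
  rw [e, mul_le_iff_le_one_right (by positivity), div_le_one (by positivity)] at hfinal
  exact hfinal
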